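/- (Closed form of the cross-covariance for Hermite variational orthogonal features.) Let v, ℓ > 0 and r > 0 with 2r² > ℓ², let s(ω) = v ℓ exp(-ℓ²ω²/2), and let ψ̃_m^{(r)}(ω) = H_m(rω) e^{-r²ω²/2} · 2^{-m/2}√r / (π^{1/4}√(m!)). Then for all real x: (2π)^{1/4} F⁻¹[ψ̃_m^{(r)} · √s](x) = i^m · (2π)^{1/4} · (2^{-m/2}√(r v ℓ))/(π^{1/4}√(m!)) · (r² + ℓ²/2)^{-1/2} · exp( -x² / (2(r² + ℓ²/2)) ) · ((r² - ℓ²/2)/(r² + ℓ²/2))^{m/2} · H_m( r x / √((r² - ℓ²/2)(r² + ℓ²/2)) ). -/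

import Mathlib

open MeasureTheory Real

/-- The physicists' Hermite polynomials: `H_0(x)=1`, `H_1(x)=2x`,
`H_{m+1}(x) = 2x H_m(x) - 2m H_{m-1}(x)`. -/
noncomputable def hermiteH : ℕ → ℝ → ℝ
  | 0, _ => 1
  | 1, x => 2 * x
  | n + 2, x => 2 * x * hermiteH (n + 1) x - 2 * (n + 1) * hermiteH n x

/-- The Hermite polynomials satisfy `H_{n+1}' = 2 (n + 1) H_n`. -/
theorem hasDerivAt_hermiteH_succ (n : ℕ) (x : ℝ) :
    HasDerivAt (hermiteH (n + 1)) (2 * (n + 1) * hermiteH n x) x := by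
  induction n using Nat.twoStepInduction with
  | zero =>
    have h : HasDerivAt (fun y : ℝ => 2 * y) (2 * 1) x := (hasDerivAt_id x).const_mul 2
    simpa [hermiteH] using h
  | one =>
    have h : HasDerivAt (fun y : ℝ => 2 * y * (2 * y) - 2 * 1)
        (2 * 1 * (2 * x) + 2 * x * (2 * 1)) x :=
      (((hasDerivAt_id x).const_mul 2).mul ((hasDerivAt_id x).const_mul 2)).sub_const _
    convert h using 1
    · ext y
      simp [hermiteH]
    · simp only [hermiteH]
      push_cast
      ring
  | more n ih₀ ih₁ =>
    have hrec : hermiteH (n + 2 + 1) = fun y => 2 * y * hermiteH (n + 1 + 1) y -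
        2 * ((n + 1 : ℕ) + 1 : ℝ) * hermiteH (n + 1) y := by
      ext y
      rw [hermiteH]
    rw [hrec]
    refine ((((hasDerivAt_id' x).const_mul 2).fun_mul ih₁).fun_sub
      (ih₀.const_mul (2 * ((n + 1 : ℕ) + 1 : ℝ)))).congr_deriv ?_
    simp only [hermiteH]
    push_cast
    ring

theorem hasDerivAt_cexp_neg_mul_sq_add_mul (b x ω : ℝ) :
    HasDerivAt (fun ω : ℝ => Complex.exp (-b * ω ^ 2 + Complex.I * x * ω))
      (Complex.exp (-b * ω ^ 2 + Complex.I * x * ω) * (-b * (2 * ω) + Complex.I * x)) ω := by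
  have hω : HasDerivAt (fun ω : ℝ => (ω : ℂ)) 1 ω := (hasDerivAt_id ω).ofReal_comp
  have h := ((hω.fun_pow 2).const_mul (-b : ℂ)).fun_add (hω.const_mul (Complex.I * x))
  simpa using h.cexp

theorem integrable_pow_mul_cexp_neg_mul_sq_add_mul {b : ℝ} (hb : 0 < b) (x : ℝ) (k : ℕ) :
    Integrable fun ω : ℝ => (ω : ℂ) ^ k * Complex.exp (-b * ω ^ 2 + Complex.I * x * ω) := by
  have hk : (-1 : ℝ) < k := by linarith [k.cast_nonneg (α := ℝ)]
  refine (integrable_rpow_mul_exp_neg_mul_sq hb hk).mono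
    (Continuous.aestronglyMeasurable (by fun_prop)) (Filter.Eventually.of_forall fun ω => ?_)
  rw [norm_mul, norm_mul, Complex.norm_exp, Real.rpow_natCast, norm_pow, norm_pow,
    Complex.norm_real, Real.norm_of_nonneg (Real.exp_pos _).le]
  have hre : (-(b : ℂ) * ω ^ 2 + Complex.I * x * ω).re = -b * ω ^ 2 := by
    rw [← Complex.ofReal_pow, ← Complex.ofReal_neg, ← Complex.ofReal_mul, Complex.add_re,
      Complex.ofReal_re]
    simp
  rw [hre]

theorem integrable_pow_mul_hermiteH_mul_cexp {b : ℝ} (hb : 0 < b) (r x : ℝ) (m k : ℕ) :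
    Integrable fun ω : ℝ => (ω : ℂ) ^ k *
      ((hermiteH m (r * ω) : ℝ) * Complex.exp (-b * ω ^ 2 + Complex.I * x * ω)) := by
  induction m using Nat.twoStepInduction generalizing k with
  | zero => simpa [hermiteH] using integrable_pow_mul_cexp_neg_mul_sq_add_mul hb x k
  | one =>
    convert (integrable_pow_mul_cexp_neg_mul_sq_add_mul hb x (k + 1)).const_mul (2 * r : ℂ)
      using 2 with ω
    simp only [hermiteH]
    push_cast
    ring
  | more n ih₀ ih₁ =>
    convert ((ih₁ (k + 1)).const_mul (2 * r : ℂ)).sub ((ih₀ k).const_mul (2 * (n + 1) : ℂ))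
      using 2 with ω
    simp only [hermiteH, Pi.sub_apply]
    push_cast
    ring

/-- Integration by parts for a Hermite polynomial against a modulated Gaussian. -/
theorem integral_mul_hermiteH_succ_mul_cexp {b : ℝ} (hb : 0 < b) (r x : ℝ) (n : ℕ) :
    2 * b * ∫ ω : ℝ, (ω : ℂ) *
        ((hermiteH (n + 1) (r * ω) : ℝ) * Complex.exp (-b * ω ^ 2 + Complex.I * x * ω)) =
      2 * (n + 1) * r * (∫ ω : ℝ, (hermiteH n (r * ω) : ℝ) *
        Complex.exp (-b * ω ^ 2 + Complex.I * x * ω)) +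
      Complex.I * x * ∫ ω : ℝ, (hermiteH (n + 1) (r * ω) : ℝ) *
        Complex.exp (-b * ω ^ 2 + Complex.I * x * ω) := by
  have i₀ := integrable_pow_mul_hermiteH_mul_cexp hb r x n 0
  have i₁ := integrable_pow_mul_hermiteH_mul_cexp hb r x (n + 1) 0
  have i₂ := integrable_pow_mul_hermiteH_mul_cexp hb r x (n + 1) 1
  simp only [pow_zero, one_mul, pow_one] at i₀ i₁ i₂
  have hderiv (ω : ℝ) : HasDerivAt
      (fun ω : ℝ => ((hermiteH (n + 1) (r * ω) : ℝ) : ℂ) *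
        Complex.exp (-b * ω ^ 2 + Complex.I * x * ω))
      (2 * (n + 1) * r * ((hermiteH n (r * ω) : ℝ) *
          Complex.exp (-b * ω ^ 2 + Complex.I * x * ω)) +
        Complex.I * x * ((hermiteH (n + 1) (r * ω) : ℝ) *
          Complex.exp (-b * ω ^ 2 + Complex.I * x * ω)) -
        2 * b * (ω * ((hermiteH (n + 1) (r * ω) : ℝ) *
          Complex.exp (-b * ω ^ 2 + Complex.I * x * ω)))) ω := by
    have h₁ : HasDerivAt (fun ω : ℝ => ((hermiteH (n + 1) (r * ω) : ℝ) : ℂ))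
        ((2 * (n + 1) * hermiteH n (r * ω) * (r * 1) : ℝ) : ℂ) ω :=
      ((hasDerivAt_hermiteH_succ n (r * ω)).comp ω ((hasDerivAt_id ω).const_mul r)).ofReal_comp
    refine (h₁.fun_mul (hasDerivAt_cexp_neg_mul_sq_add_mul b x ω)).congr_deriv ?_
    push_cast
    ring
  have h := integral_eq_zero_of_hasDerivAt_of_integrable hderiv
    (((i₀.const_mul _).fun_add (i₁.const_mul _)).sub (i₂.const_mul _)) i₁
  rw [integral_sub ((i₀.const_mul _).fun_add (i₁.const_mul _)) (i₂.const_mul _),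
    integral_add (i₀.const_mul _) (i₁.const_mul _), integral_const_mul, integral_const_mul,
    integral_const_mul] at h
  exact (sub_eq_zero.mp h).symm

/-- The Fourier integral of a dilated Hermite polynomial times a Gaussian is again a dilated
Hermite polynomial times a Gaussian. -/
theorem integral_hermiteH_mul_cexp {a r x s y : ℝ} (ha : 0 < a)
    (hs : a * s ^ 2 = 2 * r ^ 2 - a) (hy : a * (s * y) = r * x) (m : ℕ) :
    ∫ ω : ℝ, ((hermiteH m (r * ω) : ℝ) : ℂ) *
        Complex.exp (-(a / 2 : ℝ) * ω ^ 2 + Complex.I * x * ω) =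
      Complex.I ^ m * s ^ m * (hermiteH m y : ℝ) *
        ∫ ω : ℝ, Complex.exp (-(a / 2 : ℝ) * ω ^ 2 + Complex.I * x * ω) := by
  have hb : 0 < a / 2 := by positivity
  have ha' : (a : ℂ) ≠ 0 := by exact_mod_cast ha.ne'
  have hs' : (a : ℂ) * s ^ 2 = 2 * r ^ 2 - a := by exact_mod_cast hs
  have hy' : (a : ℂ) * (s * y) = r * x := by exact_mod_cast hy
  induction m using Nat.twoStepInduction with
  | zero => simp [hermiteH]
  | one =>
    have i₀ := integrable_pow_mul_cexp_neg_mul_sq_add_mul hb x 0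
    have i₁ := integrable_pow_mul_cexp_neg_mul_sq_add_mul hb x 1
    simp only [pow_zero, one_mul, pow_one] at i₀ i₁
    have hderiv (ω : ℝ) : HasDerivAt
        (fun ω : ℝ => Complex.exp (-(a / 2 : ℝ) * ω ^ 2 + Complex.I * x * ω))
        (Complex.I * x * Complex.exp (-(a / 2 : ℝ) * ω ^ 2 + Complex.I * x * ω) -
          a * (ω * Complex.exp (-(a / 2 : ℝ) * ω ^ 2 + Complex.I * x * ω))) ω := by
      refine (hasDerivAt_cexp_neg_mul_sq_add_mul (a / 2) x ω).congr_deriv ?_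
      push_cast
      ring
    have h := integral_eq_zero_of_hasDerivAt_of_integrable hderiv
      ((i₀.const_mul _).sub (i₁.const_mul _)) i₀
    rw [integral_sub (i₀.const_mul _) (i₁.const_mul _), integral_const_mul,
      integral_const_mul] at h
    have e : ∀ ω : ℝ, ((hermiteH 1 (r * ω) : ℝ) : ℂ) *
        Complex.exp (-(a / 2 : ℝ) * ω ^ 2 + Complex.I * x * ω) =
        2 * r * (ω * Complex.exp (-(a / 2 : ℝ) * ω ^ 2 + Complex.I * x * ω)) := by
      intro ω
      simp only [hermiteH]
      push_cast
      ring
    simp_rw [e]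
    rw [integral_const_mul]
    apply mul_left_cancel₀ ha'
    simp only [hermiteH]
    push_cast at h ⊢
    generalize (∫ ω : ℝ, Complex.exp (-((a : ℂ) / 2) * ω ^ 2 + Complex.I * x * ω)) = K at *
    linear_combination (-2 * r : ℂ) * h - 2 * Complex.I * K * hy'
  | more n ih₀ ih₁ =>
    have i₀ := integrable_pow_mul_hermiteH_mul_cexp hb r x n 0
    have i₂ := integrable_pow_mul_hermiteH_mul_cexp hb r x (n + 1) 1
    have h := integral_mul_hermiteH_succ_mul_cexp hb r x n
    simp only [pow_zero, one_mul, pow_one] at i₀ i₂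
    have e : ∀ ω : ℝ, ((hermiteH (n + 2) (r * ω) : ℝ) : ℂ) *
        Complex.exp (-(a / 2 : ℝ) * ω ^ 2 + Complex.I * x * ω) =
        2 * r * (ω * ((hermiteH (n + 1) (r * ω) : ℝ) *
          Complex.exp (-(a / 2 : ℝ) * ω ^ 2 + Complex.I * x * ω))) -
        2 * (n + 1) * ((hermiteH n (r * ω) : ℝ) *
          Complex.exp (-(a / 2 : ℝ) * ω ^ 2 + Complex.I * x * ω)) := by
      intro ω
      simp only [hermiteH]
      push_cast
      ring
    simp_rw [e]
    rw [integral_sub (i₂.const_mul _) (i₀.const_mul _), integral_const_mul, integral_const_mul]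
    rw [ih₀, ih₁] at h
    rw [ih₀]
    apply mul_left_cancel₀ ha'
    simp only [hermiteH]
    push_cast at h ⊢
    generalize (∫ ω : ℝ, Complex.exp (-((a : ℂ) / 2) * ω ^ 2 + Complex.I * x * ω)) = K at *
    rw [show Complex.I ^ (n + 2) = -Complex.I ^ n by rw [pow_add, Complex.I_sq]; ring]
    rw [pow_succ Complex.I n] at h
    linear_combination (2 * r : ℂ) * h +
      2 * s ^ (n + 1) * Complex.I ^ n * K * hermiteH (n + 1) y * hy' -
      2 * (n + 1) * s ^ n * Complex.I ^ n * K * hermiteH n y * hs' +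
      2 * r * x * s ^ (n + 1) * Complex.I ^ n * K * hermiteH (n + 1) y * Complex.I_sq

theorem integral_cexp_neg_half_mul_sq_add_mul {a : ℝ} (ha : 0 < a) (x : ℝ) :
    ∫ ω : ℝ, Complex.exp (-(a / 2 : ℝ) * ω ^ 2 + Complex.I * x * ω) =
      (((2 * π) ^ ((1 : ℝ) / 2) * a ^ (-(1 : ℝ) / 2) * Real.exp (-x ^ 2 / (2 * a)) : ℝ) : ℂ) := by
  have hre : (-(a / 2 : ℝ) : ℂ).re < 0 := by
    rw [← Complex.ofReal_neg, Complex.ofReal_re]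
    linarith
  have ha' : (a : ℂ) ≠ 0 := by exact_mod_cast ha.ne'
  have h := integral_cexp_quadratic hre (Complex.I * x) 0
  simp only [add_zero] at h
  rw [h]
  have h₁ : (π : ℂ) / -(-(a / 2 : ℝ) : ℂ) = ((2 * π / a : ℝ) : ℂ) := by
    push_cast
    field_simp
  have h₂ : (2 * π / a) ^ ((1 : ℝ) / 2) = (2 * π) ^ ((1 : ℝ) / 2) * a ^ (-(1 : ℝ) / 2) := by
    rw [Real.div_rpow (by positivity) ha.le, neg_div, Real.rpow_neg ha.le, div_eq_mul_inv]
  have h₃ : (0 : ℂ) - (Complex.I * x) ^ 2 / (4 * -(a / 2 : ℝ)) =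
      ((-x ^ 2 / (2 * a) : ℝ) : ℂ) := by
    push_cast
    rw [mul_pow, Complex.I_sq]
    field_simp
    ring
  rw [h₁, h₃, ← h₂, Complex.ofReal_mul, Complex.ofReal_cpow (by positivity), Complex.ofReal_exp]
  norm_num

/-- **Closed form of the cross-covariance for Hermite VOF.**
For `v, ℓ, r > 0` with `2r² > ℓ²`, with `s(ω) = vℓ e^{-ℓ²ω²/2}` and
`ψ̃_m(ω) = H_m(rω) e^{-r²ω²/2} 2^{-m/2}√r/(π^{1/4}√(m!))`, for all real `x`:
`(2π)^{1/4} F⁻¹[ψ̃_m·√s](x) = i^m (2π)^{1/4} (2^{-m/2}√(rvℓ))/(π^{1/4}√(m!))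
  (r²+ℓ²/2)^{-1/2} exp(-x²/(2(r²+ℓ²/2))) ((r²-ℓ²/2)/(r²+ℓ²/2))^{m/2}
  H_m(rx/√((r²-ℓ²/2)(r²+ℓ²/2)))`. -/
theorem statement_8 (v ℓ r : ℝ) (hv : 0 < v) (hℓ : 0 < ℓ) (hr : 0 < r)
    (h2r : ℓ ^ 2 < 2 * r ^ 2) (m : ℕ) (x : ℝ) :
    (((2 * π) ^ ((1 : ℝ) / 4) : ℝ) : ℂ) *
      ((((2 * π) ^ (-(1 : ℝ) / 2) : ℝ) : ℂ) *
        ∫ ω : ℝ,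
          ((hermiteH m (r * ω) * Real.exp (-(r ^ 2 * ω ^ 2) / 2) *
              ((2 : ℝ) ^ (-(m : ℝ) / 2) * Real.sqrt r /
                (π ^ ((1 : ℝ) / 4) * Real.sqrt (Nat.factorial m))) *
              Real.sqrt (v * ℓ * Real.exp (-(ℓ ^ 2 * ω ^ 2) / 2)) : ℝ) : ℂ) *
            Complex.exp (Complex.I * (ω : ℂ) * (x : ℂ))) =
    Complex.I ^ m * (((2 * π) ^ ((1 : ℝ) / 4) : ℝ) : ℂ) *
      (((2 : ℝ) ^ (-(m : ℝ) / 2) * Real.sqrt (r * v * ℓ) /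
          (π ^ ((1 : ℝ) / 4) * Real.sqrt (Nat.factorial m)) : ℝ) : ℂ) *
      ((((r ^ 2 + ℓ ^ 2 / 2) ^ (-(1 : ℝ) / 2) : ℝ)) : ℂ) *
      ((Real.exp (-x ^ 2 / (2 * (r ^ 2 + ℓ ^ 2 / 2))) : ℝ) : ℂ) *
      (((((r ^ 2 - ℓ ^ 2 / 2) / (r ^ 2 + ℓ ^ 2 / 2)) ^ ((m : ℝ) / 2) : ℝ)) : ℂ) *
      ((hermiteH m (r * x / Real.sqrt ((r ^ 2 - ℓ ^ 2 / 2) * (r ^ 2 + ℓ ^ 2 / 2))) : ℝ) : ℂ) := by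
  have ha : 0 < r ^ 2 + ℓ ^ 2 / 2 := by positivity
  have hb : 0 < r ^ 2 - ℓ ^ 2 / 2 := by linarith
  set a := r ^ 2 + ℓ ^ 2 / 2 with ha_def
  set b := r ^ 2 - ℓ ^ 2 / 2 with hb_def
  set c : ℝ := (2 : ℝ) ^ (-(m : ℝ) / 2) * Real.sqrt (r * v * ℓ) /
    (π ^ ((1 : ℝ) / 4) * Real.sqrt (Nat.factorial m)) with hc
  have hs : a * Real.sqrt (b / a) ^ 2 = 2 * r ^ 2 - a := by
    rw [Real.sq_sqrt (by positivity)]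
    field_simp
    rw [ha_def, hb_def]
    ring
  have hy : a * (Real.sqrt (b / a) * (r * x / Real.sqrt (b * a))) = r * x := by
    rw [Real.sqrt_div hb.le, Real.sqrt_mul hb.le]
    have h₁ := Real.sqrt_pos.mpr ha
    have h₂ := Real.sqrt_pos.mpr hb
    field_simp
    rw [Real.sq_sqrt ha.le]
  have hpow : (b / a) ^ ((m : ℝ) / 2) = Real.sqrt (b / a) ^ m := by
    rw [Real.sqrt_eq_rpow, ← Real.rpow_natCast, ← Real.rpow_mul (by positivity)]
    congr 1
    ring
  have hint : ∀ ω : ℝ,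
      ((hermiteH m (r * ω) * Real.exp (-(r ^ 2 * ω ^ 2) / 2) *
          ((2 : ℝ) ^ (-(m : ℝ) / 2) * Real.sqrt r /
            (π ^ ((1 : ℝ) / 4) * Real.sqrt (Nat.factorial m))) *
          Real.sqrt (v * ℓ * Real.exp (-(ℓ ^ 2 * ω ^ 2) / 2)) : ℝ) : ℂ) *
        Complex.exp (Complex.I * (ω : ℂ) * (x : ℂ)) =
      c * ((hermiteH m (r * ω) : ℝ) *
        Complex.exp (-(a / 2 : ℝ) * ω ^ 2 + Complex.I * x * ω)) := by
    intro ω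
    have h₁ : Real.exp (-(r ^ 2 * ω ^ 2) / 2) * Real.exp (-(ℓ ^ 2 * ω ^ 2) / 2 / 2) =
        Real.exp (-(a / 2) * ω ^ 2) := by
      rw [← Real.exp_add, ha_def]
      congr 1
      ring
    have h₂ : Real.sqrt (r * v * ℓ) = Real.sqrt r * Real.sqrt (v * ℓ) := by
      rw [mul_assoc, Real.sqrt_mul hr.le]
    have h₃ : hermiteH m (r * ω) * Real.exp (-(r ^ 2 * ω ^ 2) / 2) *
          ((2 : ℝ) ^ (-(m : ℝ) / 2) * Real.sqrt r /
            (π ^ ((1 : ℝ) / 4) * Real.sqrt (Nat.factorial m))) *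
          Real.sqrt (v * ℓ * Real.exp (-(ℓ ^ 2 * ω ^ 2) / 2)) =
        c * hermiteH m (r * ω) * Real.exp (-(a / 2) * ω ^ 2) := by
      rw [Real.sqrt_mul (by positivity), ← Real.exp_half, ← h₁, hc, h₂]
      ring
    rw [h₃, Complex.exp_add]
    push_cast
    rw [show Complex.I * (ω : ℂ) * x = Complex.I * x * ω by ring]
    ring
  have h2π : (2 * π) ^ (-(1 : ℝ) / 2) * (2 * π) ^ ((1 : ℝ) / 2) = 1 := by
    rw [← Real.rpow_add (by positivity)]
    norm_num
  have h2π' : (((2 * π) ^ (-(1 : ℝ) / 2) : ℝ) : ℂ) * (((2 * π) ^ ((1 : ℝ) / 2) : ℝ) : ℂ) = 1 := by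
    exact_mod_cast h2π
  simp_rw [hint]
  rw [integral_const_mul, integral_hermiteH_mul_cexp ha hs hy m,
    integral_cexp_neg_half_mul_sq_add_mul ha x, hpow, Complex.ofReal_mul, Complex.ofReal_mul,
    Complex.ofReal_pow]
  linear_combination (Complex.I ^ m * (((2 * π) ^ ((1 : ℝ) / 4) : ℝ) : ℂ) * c *
    ((a ^ (-(1 : ℝ) / 2) : ℝ) : ℂ) * ((Real.exp (-x ^ 2 / (2 * a)) : ℝ) : ℂ) *
    (Real.sqrt (b / a) : ℂ) ^ m *
    ((hermiteH m (r * x / Real.sqrt (b * a)) : ℝ) : ℂ)) * h2π'
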